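/- arXiv:1806.08281 — 9 statements merged into one kernel-verified Lean document; each statement's English description precedes it below -/
import Mathlib

section
/- Let k be a field, n a natural number, S = k[z_1,…,z_n], and let I, J ⊆ Fin n. For every natural number s, the Ext group Ext^s(S/A_I, S/A_J), computed in the abelian category of S-modules, is isomorphic as a k-vector space to a direct sum of copies of S/A_{I∪J} indexed by the subsets T ⊆ I ∩ J with |T| + s = |I|; that is, Ext^s_S(S/A_I, S/A_J) ≅ (S/A_{I∪J})^{⊕ binom(|I∩J|, |I|−s)}, where the binomial coefficient is interpreted as 0 when |I| − s is negative or exceeds |I∩J|. In particular this Ext group vanishes unless |I| − |I∩J| ≤ s ≤ |I|. -/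
open CategoryTheory MvPolynomial

noncomputable section

/-- `A_I`, the ideal of `k[z_1,…,z_n]` generated by the variables `z_i`, `i ∈ I`. -/
def varIdeal (k : Type) [Field k] (n : ℕ) (I : Finset (Fin n)) :
    Ideal (MvPolynomial (Fin n) k) :=
  Ideal.span ((fun i => (X i : MvPolynomial (Fin n) k)) '' ↑I)

/-- The cyclic module `S/A_I` as an object of `ModuleCat S`. -/
def cyclicMod (k : Type) [Field k] (n : ℕ) (I : Finset (Fin n)) :
    ModuleCat (MvPolynomial (Fin n) k) :=
  ModuleCat.of (MvPolynomial (Fin n) k) (MvPolynomial (Fin n) k ⧸ varIdeal k n I)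

section Bridge
universe v u
variable {k : Type v} [CommRing k] {C : Type u} [Category.{v} C] [Abelian C] [Linear k C]
  [HasExt.{v} C]

lemma extMk_zero_eq_zero_iff {X Y : C} (R : ProjectiveResolution X) (f : R.complex.X 0 ⟶ Y)
    (m : ℕ) (hm : 0 + 1 = m) (hf : R.complex.d m 0 ≫ f = 0) :
    R.extMk f m hm hf = 0 ↔ f = 0 := by
  constructor
  · intro h
    simp only [← R.extEquivCohomologyClass.apply_eq_iff_eq,
      ProjectiveResolution.extEquivCohomologyClass_extMk,
      ProjectiveResolution.extEquivCohomologyClass_zero,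
      CochainComplex.HomComplex.CohomologyClass.mk_eq_zero_iff] at h
    rw [CochainComplex.HomComplex.Cocycle.toSingleMk_mem_coboundaries_iff _ _ _ _ _ 1 (by simp)] at h
    obtain ⟨g, hg⟩ := h
    have hz : Limits.IsZero (R.cochainComplex.X 1) :=
      R.cochainComplex.isZero_of_isStrictlyLE 0 1 (by lia)
    rw [hz.eq_of_src g 0, Limits.comp_zero] at hg
    rw [← cancel_epi (R.cochainComplexXIso (-(0:ℕ)) 0 rfl).hom]
    simpa using hg.symm
  · rintro rfl
    simp

lemma extMk_smul' {X Y : C} (R : ProjectiveResolution X) {n : ℕ} (f : R.complex.X n ⟶ Y)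
    (m : ℕ) (hm : n + 1 = m) (hf : R.complex.d m n ≫ f = 0) (r : k) :
    R.extMk (r • f) m hm (by simp [hf]) = r • R.extMk f m hm hf := by
  rw [Abelian.Ext.smul_eq_comp_mk₀, ProjectiveResolution.extMk_comp_mk₀]
  congr 1
  simp

/-- The map from cocycles in the Hom complex of a projective resolution to `Ext`. -/
def extMkLin {X Y : C} (R : ProjectiveResolution X) (s i : ℕ) :
    LinearMap.ker ((R.complex.linearYonedaObj k Y).sc' i s (s+1)).g.hom →ₗ[k] Abelian.Ext X Y s where
  toFun f := R.extMk (f.1 : R.complex.X s ⟶ Y) (s+1) rfl f.2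
  map_add' _ _ := (R.add_extMk _ _ _ _ _ _).symm
  map_smul' r f := extMk_smul' R (f.1 : R.complex.X s ⟶ Y) (s+1) rfl f.2 r

lemma extMkLin_surj {X Y : C} (R : ProjectiveResolution X) (s i : ℕ) :
    Function.Surjective (extMkLin (k := k) (Y := Y) R s i) := by
  intro α
  obtain ⟨f, hf, rfl⟩ := R.extMk_surjective α (s+1) rfl
  exact ⟨⟨f, hf⟩, rfl⟩

lemma extMkLin_ker {X Y : C} (R : ProjectiveResolution X) (s i : ℕ)
    (hi : (ComplexShape.up ℕ).prev s = i) :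
    LinearMap.range ((R.complex.linearYonedaObj k Y).sc' i s (s+1)).moduleCatToCycles =
      LinearMap.ker (extMkLin (k := k) (Y := Y) R s i) := by
  ext ⟨f, hf⟩
  rw [LinearMap.mem_ker, LinearMap.mem_range]
  cases s with
  | zero =>
    have h1 : extMkLin (k := k) (Y := Y) R 0 i ⟨f, hf⟩ = 0 ↔ (f : R.complex.X 0 ⟶ Y) = 0 :=
      extMk_zero_eq_zero_iff R f 1 rfl hf
    rw [h1]
    have hd : R.complex.d 0 i = 0 := R.complex.shape _ _ (by simp)
    constructor
    · rintro ⟨g, hg⟩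
      have : R.complex.d 0 i ≫ (g : R.complex.X i ⟶ Y) = f := congrArg Subtype.val hg
      have h2 : ∀ g : R.complex.X i ⟶ Y, R.complex.d 0 i ≫ g = 0 := by
        intro g; rw [hd, Limits.zero_comp]
      exact this.symm.trans (h2 g)
    · intro h0
      exact ⟨0, by rw [map_zero]; exact Subtype.ext h0.symm⟩
  | succ p =>
    obtain rfl : p = i := by rw [← hi]; simp
    have h1 : extMkLin (k := k) (Y := Y) R (p+1) p ⟨f, hf⟩ = 0 ↔ _ :=
      R.extMk_eq_zero_iff f (p+1+1) rfl hf p rfl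
    rw [h1]
    constructor
    · rintro ⟨g, hg⟩
      exact ⟨g, congrArg Subtype.val hg⟩
    · rintro ⟨g, hg⟩
      exact ⟨g, Subtype.ext hg⟩

variable (k) in
theorem ext_bridge [EnoughProjectives C] (X Y : C) (s : ℕ) :
    Nonempty ((((Ext k C s).obj (Opposite.op X)).obj Y) ≃ₗ[k] Abelian.Ext X Y s) := by
  let R := projectiveResolution X
  let i := (ComplexShape.up ℕ).prev s
  let e1 := R.isoExt (R := k) s Y
  let K := R.complex.linearYonedaObj k Y
  let e2 : K.homology s ≅ (K.sc' i s (s+1)).homology :=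
    ShortComplex.homologyMapIso (K.isoSc' i s (s+1) rfl (by simp))
  let e3 := (K.sc' i s (s+1)).moduleCatHomologyIso
  let e4 := (Submodule.quotEquivOfEq _ _ (extMkLin_ker (k := k) (Y := Y) R s i rfl)).trans
    ((extMkLin (k := k) (Y := Y) R s i).quotKerEquivOfSurjective (extMkLin_surj R s i))
  exact ⟨(e1 ≪≫ e2 ≪≫ e3).toLinearEquiv.trans e4⟩
end Bridge

section Algebra

variable {S : Type*} [CommRing S]

lemma equiv_of_ker_eq {A C D : Type*} [AddCommGroup A] [AddCommGroup C] [AddCommGroup D]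
    [Module S A] [Module S C] [Module S D] (f : A →ₗ[S] C) (g : A →ₗ[S] D)
    (hf : Function.Surjective f) (hg : Function.Surjective g)
    (h : ∀ a, f a = 0 ↔ g a = 0) : Nonempty (C ≃ₗ[S] D) := by
  have hk : LinearMap.ker f = LinearMap.ker g := by
    ext a; simp [h]
  exact ⟨(f.quotKerEquivOfSurjective hf).symm.trans
    ((Submodule.quotEquivOfEq _ _ hk).trans (g.quotKerEquivOfSurjective hg))⟩

lemma split_equiv {E0 N E1 : Type*} [AddCommGroup E0] [AddCommGroup N] [AddCommGroup E1]
    [Module S E0] [Module S N] [Module S E1] (𝔞 : Ideal S) (a b c : ℕ) (hc : c = a + b)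
    (e0 : E0 ≃ₗ[S] (Fin a → S ⧸ 𝔞)) (e1 : E1 ≃ₗ[S] (Fin b → S ⧸ 𝔞))
    (δ : E0 →ₗ[S] N) (g : N →ₗ[S] E1) (hδ : Function.Injective δ)
    (hg : Function.Surjective g) (hex : Function.Exact δ g)
    (hN : ∀ r ∈ 𝔞, ∀ x : N, r • x = 0) :
    Nonempty (N ≃ₗ[S] (Fin c → S ⧸ 𝔞)) := by
  classical
  subst hc
  choose y hy using fun t : Fin b => hg (e1.symm (Pi.single t 1))
  let σt : Fin b → (S ⧸ 𝔞) →ₗ[S] N := fun t =>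
    Submodule.liftQ 𝔞 (LinearMap.toSpanSingleton S N (y t)) (by
      intro r hr
      simpa using hN r hr (y t))
  let σ : (Fin b → S ⧸ 𝔞) →ₗ[S] N := LinearMap.lsum S (fun _ => S ⧸ 𝔞) S σt
  have hσ : g ∘ₗ σ = e1.symm.toLinearMap := by
    refine LinearMap.pi_ext' fun t => ?_
    refine Submodule.linearMap_qext _ ?_
    ext
    have : σ (Pi.single t 1) = y t := by
      have h2 : σ (Pi.single t 1) = σt t 1 := by
        simp [σ, LinearMap.lsum_apply, Pi.single_apply, Finset.sum_apply, apply_ite]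
      have h3 : σt t (Submodule.Quotient.mk 1) = y t := by
        refine (Submodule.liftQ_apply _ _ _).trans ?_
        simp
      exact h2.trans h3
    have h1 : g (σ (Pi.single t 1)) = e1.symm (Pi.single t 1) := by rw [this, hy]
    simpa using h1
  have hs : g ∘ₗ (σ ∘ₗ e1.toLinearMap) = LinearMap.id := by
    rw [← LinearMap.comp_assoc, hσ]; ext; simp
  let e := (hex.splitSurjectiveEquiv hδ ⟨_, hs⟩).1
  exact ⟨e.trans <| (e0.prodCongr e1).trans <| (LinearEquiv.sumArrowLequivProdArrow (Fin a) (Fin b) S (S ⧸ 𝔞)).symm.trans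
    (LinearEquiv.funCongrLeft S (S ⧸ 𝔞) finSumFinEquiv.symm)⟩

end Algebra

section Var
variable (k : Type) [Field k] (n : ℕ)

lemma mem_varIdeal (I : Finset (Fin n)) (p : MvPolynomial (Fin n) k) :
    p ∈ varIdeal k n I ↔ ∀ m ∈ p.support, ∃ i ∈ I, m i ≠ 0 := by
  rw [varIdeal]
  simpa using MvPolynomial.mem_ideal_span_X_image (x := p) (s := (I : Set (Fin n)))

lemma varIdeal_insert (i : Fin n) (I : Finset (Fin n)) :
    varIdeal k n (insert i I) = Ideal.span {X i} ⊔ varIdeal k n I := by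
  simp [varIdeal, Set.image_insert_eq, Ideal.span_insert]

lemma varIdeal_mono {I J : Finset (Fin n)} (h : I ⊆ J) : varIdeal k n I ≤ varIdeal k n J :=
  Ideal.span_mono (Set.image_mono (by exact_mod_cast h))

lemma varIdeal_union (I J : Finset (Fin n)) :
    varIdeal k n (I ∪ J) = varIdeal k n I ⊔ varIdeal k n J := by
  simp [varIdeal, Set.image_union]

lemma X_mem_varIdeal {i : Fin n} {I : Finset (Fin n)} (h : i ∈ I) :
    (X i : MvPolynomial (Fin n) k) ∈ varIdeal k n I :=
  Ideal.subset_span ⟨i, by exact_mod_cast h, rfl⟩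

lemma X_mul_mem {i : Fin n} {I : Finset (Fin n)} (h : i ∉ I) (p : MvPolynomial (Fin n) k)
    (hp : X i * p ∈ varIdeal k n I) : p ∈ varIdeal k n I := by
  rw [mem_varIdeal] at hp ⊢
  intro m hm
  obtain ⟨j, hj, hmj⟩ := hp (Finsupp.single i 1 + m) (by
    rw [mem_support_iff, coeff_X_mul]; exact mem_support_iff.mp hm)
  refine ⟨j, hj, ?_⟩
  have : i ≠ j := fun e => h (e ▸ hj)
  simpa [Finsupp.single_apply, this] using hmj

/-- the projection `S/A_I → S/A_{I ∪ i}`. -/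
def projMap (i : Fin n) (I : Finset (Fin n)) :
    (MvPolynomial (Fin n) k ⧸ varIdeal k n I) →ₗ[MvPolynomial (Fin n) k]
      (MvPolynomial (Fin n) k ⧸ varIdeal k n (insert i I)) :=
  Submodule.factor (varIdeal_mono k n (Finset.subset_insert i I))

lemma projMap_surj (i : Fin n) (I : Finset (Fin n)) :
    Function.Surjective (projMap k n i I) :=
  Submodule.factor_surjective (varIdeal_mono k n (Finset.subset_insert i I))

lemma projMap_eq_zero (i : Fin n) (I : Finset (Fin n)) (q) :
    projMap k n i I q = 0 ↔ ∃ q', (X i : MvPolynomial (Fin n) k) • q' = q := by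
  obtain ⟨p, rfl⟩ := Submodule.Quotient.mk_surjective _ q
  constructor
  · intro h
    have h1 : p ∈ varIdeal k n (insert i I) := by
      rw [← Submodule.Quotient.mk_eq_zero]; exact h
    rw [varIdeal_insert, Submodule.mem_sup] at h1
    obtain ⟨y, hy, z, hz, rfl⟩ := h1
    obtain ⟨a, rfl⟩ := Ideal.mem_span_singleton'.mp hy
    refine ⟨Submodule.Quotient.mk a, ?_⟩
    rw [← Submodule.Quotient.mk_smul, Submodule.Quotient.eq]
    have : ((X i : MvPolynomial (Fin n) k) • a - (a * X i + z) : MvPolynomial (Fin n) k) = - z := by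
      simp only [smul_eq_mul]; ring
    rw [this]
    exact neg_mem hz
  · rintro ⟨q', hq⟩
    rw [← hq, map_smul]
    obtain ⟨p', hp⟩ := Submodule.Quotient.mk_surjective _ (projMap k n i I q')
    rw [← hp, ← Submodule.Quotient.mk_smul, Submodule.Quotient.mk_eq_zero]
    exact Ideal.mul_mem_right _ _ (X_mem_varIdeal k n (Finset.mem_insert_self i I))

lemma X_smul_inj {i : Fin n} {I : Finset (Fin n)} (h : i ∉ I)
    (q : MvPolynomial (Fin n) k ⧸ varIdeal k n I)
    (hq : (X i : MvPolynomial (Fin n) k) • q = 0) : q = 0 := by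
  obtain ⟨p, rfl⟩ := Submodule.Quotient.mk_surjective _ q
  rw [← Submodule.Quotient.mk_smul, Submodule.Quotient.mk_eq_zero] at hq
  rw [Submodule.Quotient.mk_eq_zero]
  exact X_mul_mem k n h p hq

lemma smul_quot_eq_zero (I : Finset (Fin n)) (a : MvPolynomial (Fin n) k)
    (ha : a ∈ varIdeal k n I) (q : MvPolynomial (Fin n) k ⧸ varIdeal k n I) : a • q = 0 := by
  obtain ⟨p, rfl⟩ := Submodule.Quotient.mk_surjective _ q
  rw [← Submodule.Quotient.mk_smul, Submodule.Quotient.mk_eq_zero]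
  exact Ideal.mul_mem_right _ _ ha

lemma smul_id_eq_zero (I : Finset (Fin n)) (a : MvPolynomial (Fin n) k)
    (ha : a ∈ varIdeal k n I) : a • 𝟙 (cyclicMod k n I) = 0 := by
  ext q
  exact smul_quot_eq_zero k n I a ha q

lemma ext_smul_left {S : Type} [CommRing S] {A B : ModuleCat.{0} S} {s : ℕ} (r : S)
    (x : Abelian.Ext A B s) :
    r • x = (Abelian.Ext.mk₀ (r • 𝟙 A)).comp x (zero_add s) := by
  simp [Abelian.Ext.mk₀_smul]

lemma hgen {S : Type} [CommRing S] (T : ShortComplex (ModuleCat.{0} S)) (B : ModuleCat.{0} S)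
    (s : ℕ) (y : Abelian.Ext T.X₃ B s) :
    (Abelian.Ext.mk₀ T.f).comp ((Abelian.Ext.mk₀ T.g).comp y (zero_add s)) (zero_add s) = 0 := by
  rw [Abelian.Ext.mk₀_comp_mk₀_assoc, T.zero]
  simp

lemma ext_killed (I J : Finset (Fin n)) (s : ℕ) (a : MvPolynomial (Fin n) k)
    (ha : a ∈ varIdeal k n (I ∪ J))
    (x : Abelian.Ext (cyclicMod k n I) (cyclicMod k n J) s) : a • x = 0 := by
  rw [varIdeal_union, Submodule.mem_sup] at ha
  obtain ⟨y, hy, z, hz, rfl⟩ := ha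
  rw [add_smul, ext_smul_left y, Abelian.Ext.smul_eq_comp_mk₀ x z, smul_id_eq_zero k n I y hy,
    smul_id_eq_zero k n J z hz]
  simp

/-- The short exact sequence `0 → S/A_I → S/A_I → S/A_{I ∪ i} → 0`. -/
def varSeq (i : Fin n) (I : Finset (Fin n)) : ShortComplex (ModuleCat (MvPolynomial (Fin n) k)) where
  X₁ := cyclicMod k n I
  X₂ := cyclicMod k n I
  X₃ := cyclicMod k n (insert i I)
  f := (X i : MvPolynomial (Fin n) k) • 𝟙 _
  g := ModuleCat.ofHom (projMap k n i I)
  zero := by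
    ext q
    exact (projMap_eq_zero k n i I _).2 ⟨q, rfl⟩

lemma varSeq_shortExact {i : Fin n} {I : Finset (Fin n)} (h : i ∉ I) :
    (varSeq k n i I).ShortExact := by
  apply ModuleCat.shortComplex_shortExact
  · intro q
    exact projMap_eq_zero k n i I q
  · intro q q' hq
    rw [← sub_eq_zero]
    refine X_smul_inj k n h _ ?_
    exact (smul_sub (X i : MvPolynomial (Fin n) k) q q').trans (sub_eq_zero.2 hq)
  · exact projMap_surj k n i I

/-- The number of summands. -/
def cnt (I J : Finset (Fin n)) (s : ℕ) : ℕ :=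
  if s ≤ I.card then ((I ∩ J).card).choose (I.card - s) else 0

theorem ext_compute (I J : Finset (Fin n)) : ∀ s : ℕ,
    Nonempty (Abelian.Ext (cyclicMod k n I) (cyclicMod k n J) s ≃ₗ[MvPolynomial (Fin n) k]
      (Fin (cnt n I J s) → MvPolynomial (Fin n) k ⧸ varIdeal k n (I ∪ J))) := by
  induction I using Finset.induction_on with
  | empty =>
    intro s
    rw [Finset.empty_union]
    let eb : cyclicMod k n ∅ ≅ ModuleCat.of (MvPolynomial (Fin n) k) (MvPolynomial (Fin n) k) :=
      LinearEquiv.toModuleIso (Submodule.quotEquivOfEqBot (varIdeal k n ∅) (by simp [varIdeal]))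
    have hp : Projective (cyclicMod k n ∅) := Projective.of_iso eb.symm
      (IsProjective.iff_projective _ |>.1 inferInstance)
    cases s with
    | zero =>
      have hc : cnt n ∅ J 0 = 1 := by simp [cnt]
      rw [hc]
      let e1 := Abelian.Ext.linearEquiv₀ (R := MvPolynomial (Fin n) k) (X := cyclicMod k n ∅)
        (Y := cyclicMod k n J)
      let e2 : (cyclicMod k n ∅ ⟶ cyclicMod k n J) ≃ₗ[MvPolynomial (Fin n) k]
        (ModuleCat.of (MvPolynomial (Fin n) k) (MvPolynomial (Fin n) k) ⟶ cyclicMod k n J) :=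
        Linear.homCongr _ eb (Iso.refl _)
      let e3 := ModuleCat.homLinearEquiv (S := MvPolynomial (Fin n) k)
        (M := ModuleCat.of (MvPolynomial (Fin n) k) (MvPolynomial (Fin n) k))
        (N := cyclicMod k n J)
      let e4 := LinearMap.ringLmapEquivSelf (MvPolynomial (Fin n) k) (MvPolynomial (Fin n) k)
        (MvPolynomial (Fin n) k ⧸ varIdeal k n J)
      let e5 := (LinearEquiv.funUnique (Fin 1) (MvPolynomial (Fin n) k)
        (MvPolynomial (Fin n) k ⧸ varIdeal k n J)).symm
      exact ⟨((e1.trans e2).trans e3).trans (e4.trans e5)⟩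
    | succ s =>
      have hc : cnt n ∅ J (s+1) = 0 := by simp [cnt]
      rw [hc]
      have : Subsingleton (Abelian.Ext (cyclicMod k n ∅) (cyclicMod k n J) (s+1)) :=
        subsingleton_of_forall_eq 0 Abelian.Ext.eq_zero_of_projective
      exact ⟨LinearEquiv.ofSubsingleton _ _⟩
  | insert i I hi ih =>
    have hS := varSeq_shortExact k n hi
    let δ (s : ℕ) : Abelian.Ext (cyclicMod k n I) (cyclicMod k n J) s →ₗ[MvPolynomial (Fin n) k]
        Abelian.Ext (cyclicMod k n (insert i I)) (cyclicMod k n J) (s+1) :=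
      Abelian.Ext.precompOfLinear hS.extClass (MvPolynomial (Fin n) k) (cyclicMod k n J)
        (add_comm 1 s)
    let g (s : ℕ) : Abelian.Ext (cyclicMod k n (insert i I)) (cyclicMod k n J) s
        →ₗ[MvPolynomial (Fin n) k] Abelian.Ext (cyclicMod k n I) (cyclicMod k n J) s :=
      Abelian.Ext.precompOfLinear (Abelian.Ext.mk₀ (varSeq k n i I).g) (MvPolynomial (Fin n) k)
        (cyclicMod k n J) (zero_add s)
    have h0 : Function.Injective (g 0) :=
      have := hS.epi_g
      Abelian.Ext.precomp_mk₀_injective_of_epi (cyclicMod k n J) (varSeq k n i I).g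
    have h1 (s : ℕ) (x) : δ s x = 0 ↔ ∃ y, (X i : MvPolynomial (Fin n) k) • y = x := by
      constructor
      · intro h
        obtain ⟨y, hy⟩ := Abelian.Ext.contravariant_sequence_exact₁ hS _ x (add_comm 1 s) h
        exact ⟨y, (ext_smul_left _ _).trans hy⟩
      · rintro ⟨y, rfl⟩
        rw [ext_smul_left]
        exact hS.extClass_comp_assoc y (h := add_comm 1 s)
    have h2 (s : ℕ) (x) : (X i : MvPolynomial (Fin n) k) • x = 0 ↔ ∃ y, g s y = x := by
      constructor
      · intro h
        exact Abelian.Ext.contravariant_sequence_exact₂ hS _ x ((ext_smul_left _ _).symm.trans h)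
      · rintro ⟨y, rfl⟩
        rw [ext_smul_left]
        exact hgen (varSeq k n i I) _ s y
    have h3 (s : ℕ) (x) : g (s+1) x = 0 ↔ ∃ y, δ s y = x := by
      constructor
      · intro h
        exact Abelian.Ext.contravariant_sequence_exact₃ hS _ x h (add_comm 1 s)
      · rintro ⟨y, rfl⟩
        exact hS.comp_extClass_assoc y (add_comm 1 s)
    by_cases hJ : i ∈ J
    · have hU : insert i I ∪ J = I ∪ J := by
        rw [Finset.insert_union, Finset.insert_eq_self]; simp [hJ]
      have hz (s : ℕ) (x : Abelian.Ext (cyclicMod k n I) (cyclicMod k n J) s) :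
          (X i : MvPolynomial (Fin n) k) • x = 0 :=
        ext_killed k n I J s _ (X_mem_varIdeal k n (by simp [hJ])) x
      have hgs (s : ℕ) : Function.Surjective (g s) := fun x => (h2 s x).1 (hz s x)
      have hinter : insert i I ∩ J = insert i (I ∩ J) := Finset.insert_inter_of_mem hJ
      have hcard : (I ∩ J).card ≤ I.card := Finset.card_le_card Finset.inter_subset_left
      have hni : i ∉ I ∩ J := by simp [hi]
      intro s
      rw [hU]
      cases s with
      | zero =>
        have hc : cnt n (insert i I) J 0 = cnt n I J 0 := by
          simp only [cnt, hinter, Finset.card_insert_of_notMem hni, Finset.card_insert_of_notMem hi]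
          simp [Nat.choose_succ_succ, Nat.choose_eq_zero_of_lt (Nat.lt_succ_of_le hcard)]
        rw [hc]
        obtain ⟨e⟩ := ih 0
        exact ⟨(LinearEquiv.ofBijective (g 0) ⟨h0, hgs 0⟩).trans e⟩
      | succ s =>
        obtain ⟨e0⟩ := ih s
        obtain ⟨e1⟩ := ih (s+1)
        refine split_equiv _ _ _ _ ?_ e0 e1 (δ s) (g (s+1)) ?_ (hgs _) (fun x => h3 s x) ?_
        · simp only [cnt, hinter, Finset.card_insert_of_notMem hni, Finset.card_insert_of_notMem hi]
          rcases lt_trichotomy s I.card with h | h | h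
          · obtain ⟨d, hd⟩ := Nat.exists_eq_add_of_lt h
            have e1 : I.card + 1 - (s + 1) = d + 1 := by lia
            have e2 : I.card - s = d + 1 := by lia
            have e3 : I.card - (s + 1) = d := by lia
            rw [if_pos (by lia), if_pos (by lia), if_pos (by lia), e1, e2, e3,
              Nat.choose_succ_succ, add_comm]
          · subst h; simp
          · rw [if_neg (by lia), if_neg (by lia), if_neg (by lia)]
        · rw [injective_iff_map_eq_zero]
          intro x hx
          obtain ⟨y, rfl⟩ := (h1 s x).1 hx
          exact hz s y
        · intro r hr x
          exact ext_killed k n (insert i I) J _ r (by rw [hU]; exact hr) x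
    · have hiU : i ∉ I ∪ J := by simp [hi, hJ]
      have hU : insert i I ∪ J = insert i (I ∪ J) := Finset.insert_union _ _ _
      have hinter : insert i I ∩ J = I ∩ J := Finset.insert_inter_of_notMem hJ
      have hcard : (I ∩ J).card ≤ I.card := Finset.card_le_card Finset.inter_subset_left
      have hz (s : ℕ) (x : Abelian.Ext (cyclicMod k n I) (cyclicMod k n J) s)
          (hx : (X i : MvPolynomial (Fin n) k) • x = 0) : x = 0 := by
        obtain ⟨e⟩ := ih s
        apply e.injective
        rw [map_zero]
        funext t
        refine X_smul_inj k n hiU _ ?_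
        have := congrFun (congrArg e hx) t
        rw [map_smul, map_zero] at this
        exact this
      have hg0 (s : ℕ) (x) : g s x = 0 := hz s _ ((h2 s _).2 ⟨x, rfl⟩)
      intro s
      rw [hU]
      cases s with
      | zero =>
        have hc : cnt n (insert i I) J 0 = 0 := by
          simp only [cnt, hinter, Finset.card_insert_of_notMem hi]
          simp [Nat.choose_eq_zero_of_lt (Nat.lt_succ_of_le hcard)]
        rw [hc]
        have : Subsingleton (Abelian.Ext (cyclicMod k n (insert i I)) (cyclicMod k n J) 0) :=
          ⟨fun x y => h0 (by rw [hg0, hg0])⟩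
        exact ⟨LinearEquiv.ofSubsingleton _ _⟩
      | succ s =>
        have hc : cnt n (insert i I) J (s+1) = cnt n I J s := by
          simp only [cnt, hinter, Finset.card_insert_of_notMem hi]
          simp
        rw [hc]
        obtain ⟨e⟩ := ih s
        refine equiv_of_ker_eq (δ s ∘ₗ e.symm.toLinearMap)
          ((projMap k n i (I ∪ J)).compLeft (Fin (cnt n I J s))) ?_ ?_ ?_
        · exact Function.Surjective.comp (g := δ s)
            (fun x => (h3 s x).1 (hg0 _ _)) e.symm.surjective
        · exact (projMap_surj k n i (I ∪ J)).comp_left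
        · intro a
          change δ s (e.symm a) = 0 ↔ _
          rw [h1]
          constructor
          · rintro ⟨y, hy⟩
            funext t
            refine (projMap_eq_zero k n i (I ∪ J) _).2 ⟨e y t, ?_⟩
            have : a = e ((X i : MvPolynomial (Fin n) k) • y) := by rw [hy]; simp
            rw [this, map_smul]; rfl
          · intro h
            choose q hq using fun t => (projMap_eq_zero k n i (I ∪ J) (a t)).1 (congrFun h t)
            refine ⟨e.symm q, ?_⟩
            rw [← map_smul]
            congr 1
            funext t
            exact hq t

end Var

lemma card_index (n : ℕ) (I J : Finset (Fin n)) (s : ℕ) :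
    Fintype.card {T : Finset (Fin n) // T ⊆ I ∩ J ∧ T.card + s = I.card} = cnt n I J s := by
  rw [Fintype.card_subtype, cnt]
  split_ifs with h
  · rw [← Finset.card_powersetCard]
    congr 1
    ext T
    simp only [Finset.mem_filter, Finset.mem_univ, true_and, Finset.mem_powersetCard]
    exact and_congr_right fun _ => by lia
  · rw [Finset.card_eq_zero, Finset.filter_eq_empty_iff]
    rintro T - ⟨_, h2⟩
    lia

lemma ext_k_smul (k : Type) [Field k] (n : ℕ) (A B : ModuleCat.{0} (MvPolynomial (Fin n) k))
    (s : ℕ) (c : k) (x : Abelian.Ext A B s) :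
    c • x = (algebraMap k (MvPolynomial (Fin n) k) c) • x := by
  rw [Abelian.Ext.smul_eq_comp_mk₀, Abelian.Ext.smul_eq_comp_mk₀]
  rfl

/-- `Ext^s_S(S/A_I, S/A_J)`, computed in the abelian category of
`S`-modules, is isomorphic as a `k`-vector space to the direct sum of copies of
`S/A_{I∪J}` indexed by the subsets `T ⊆ I ∩ J` with `|T| + s = |I|`; the number of
such subsets is `binom(|I∩J|, |I|−s)` (interpreted as `0` when `|I|−s` is negative
or exceeds `|I∩J|`); in particular the Ext group vanishes unless
`|I| − |I∩J| ≤ s ≤ |I|`. -/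
theorem stmt0 (k : Type) [Field k] (n : ℕ) (I J : Finset (Fin n)) (s : ℕ) :
    Nonempty
      ((((Ext k (ModuleCat (MvPolynomial (Fin n) k)) s).obj
          (Opposite.op (cyclicMod k n I))).obj (cyclicMod k n J)) ≃ₗ[k]
        ({T : Finset (Fin n) // T ⊆ I ∩ J ∧ T.card + s = I.card} →
          MvPolynomial (Fin n) k ⧸ varIdeal k n (I ∪ J))) ∧
    Fintype.card {T : Finset (Fin n) // T ⊆ I ∩ J ∧ T.card + s = I.card} =
      (if s ≤ I.card then ((I ∩ J).card).choose (I.card - s) else 0) ∧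
    (¬ (I.card - (I ∩ J).card ≤ s ∧ s ≤ I.card) →
      Subsingleton (((Ext k (ModuleCat (MvPolynomial (Fin n) k)) s).obj
        (Opposite.op (cyclicMod k n I))).obj (cyclicMod k n J))) := by
  have hcard := card_index n I J s
  have key : Nonempty
      ((((Ext k (ModuleCat (MvPolynomial (Fin n) k)) s).obj
          (Opposite.op (cyclicMod k n I))).obj (cyclicMod k n J)) ≃ₗ[k]
        ({T : Finset (Fin n) // T ⊆ I ∩ J ∧ T.card + s = I.card} →
          MvPolynomial (Fin n) k ⧸ varIdeal k n (I ∪ J))) := by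
    obtain ⟨e1⟩ := ext_bridge k (cyclicMod k n I) (cyclicMod k n J) s
    obtain ⟨e2⟩ := ext_compute k n I J s
    let e3 : Abelian.Ext (cyclicMod k n I) (cyclicMod k n J) s ≃ₗ[k]
        (Fin (cnt n I J s) → MvPolynomial (Fin n) k ⧸ varIdeal k n (I ∪ J)) :=
      { e2 with
        map_smul' := fun c x => by
          change e2 (c • x) = c • e2 x
          rw [ext_k_smul, map_smul, algebraMap_smul] }
    let e4 := LinearEquiv.funCongrLeft k (MvPolynomial (Fin n) k ⧸ varIdeal k n (I ∪ J))
      (Fintype.equivFinOfCardEq hcard)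
    exact ⟨e1.trans (e3.trans e4)⟩
  refine ⟨key, hcard, fun h => ?_⟩
  obtain ⟨e⟩ := key
  have hemp : IsEmpty {T : Finset (Fin n) // T ⊆ I ∩ J ∧ T.card + s = I.card} := by
    refine ⟨fun ⟨T, hT, hs⟩ => h ?_⟩
    have := Finset.card_le_card hT
    constructor <;> lia
  exact e.toEquiv.subsingleton
end
end

section
/- Let k be a field, n a natural number, S = k[z_1,…,z_n], I, J ⊆ Fin n, and d : Fin n → ℤ. The quotient S/A_J is the direct sum of its multidegree components, where for m′ ∈ ℤ^n the multidegree-m′ component is the k-line spanned by the class of the monomial z^{m′} if m′ has all coordinates nonnegative and m′_j = 0 for every j ∈ J, and is the zero subspace otherwise. Call an S-module homomorphism f : S/A_I → S/A_J homogeneous of degree d if for every monomial z^m with m_i = 0 for all i ∈ I, the element f([z^m]) lies in the multidegree-(m+d) component of S/A_J. Then the k-vector space of S-module homomorphisms S/A_I → S/A_J homogeneous of degree d is one-dimensional if I ⊆ J, d_j = 0 for every j ∈ J, and d_i ≥ 0 for every i ∈ Fin n; otherwise it is the zero space. -/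
open MvPolynomial

noncomputable section

/-- The multidegree-`m'` component of `S/A_J`: the `k`-line spanned by the class of
the monomial `z^{m'}` if `m'` has all coordinates nonnegative and `m'_j = 0` for all
`j ∈ J`, and the zero subspace otherwise. -/
def mdegComponent (k : Type) [Field k] (n : ℕ) (J : Finset (Fin n)) (m' : Fin n → ℤ) :
    Submodule k (MvPolynomial (Fin n) k ⧸ varIdeal k n J) :=
  if (∀ i, 0 ≤ m' i) ∧ (∀ j ∈ J, m' j = 0) then
    Submodule.span k
      {Ideal.Quotient.mk (varIdeal k n J)
        (monomial (Finsupp.equivFunOnFinite.symm fun i => (m' i).toNat) (1 : k))}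
  else ⊥

/-- An `S`-module homomorphism `f : S/A_I → S/A_J` is homogeneous of degree `d` if
for every monomial `z^m` with `m_i = 0` for all `i ∈ I`, the element `f([z^m])` lies
in the multidegree-`(m+d)` component of `S/A_J`. -/
def IsHomogOfDegree (k : Type) [Field k] (n : ℕ) (I J : Finset (Fin n)) (d : Fin n → ℤ)
    (f : (MvPolynomial (Fin n) k ⧸ varIdeal k n I) →ₗ[MvPolynomial (Fin n) k]
      (MvPolynomial (Fin n) k ⧸ varIdeal k n J)) : Prop :=
  ∀ m : Fin n →₀ ℕ, (∀ i ∈ I, m i = 0) →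
    f (Ideal.Quotient.mk (varIdeal k n I) (monomial m (1 : k))) ∈
      mdegComponent k n J fun i => (m i : ℤ) + d i

theorem mem_varIdeal_aux (k : Type) [Field k] (n : ℕ) (J : Finset (Fin n))
    (p : MvPolynomial (Fin n) k) :
    p ∈ varIdeal k n J ↔ ∀ m ∈ p.support, ∃ i ∈ J, m i ≠ 0 := by
  unfold varIdeal
  rw [MvPolynomial.mem_ideal_span_X_image]
  simp

theorem exists_coeff_aux (k : Type) [Field k] (n : ℕ) (J : Finset (Fin n))
    (m : Fin n →₀ ℕ) (hm : ∀ j ∈ J, m j = 0) :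
    ∃ c : (MvPolynomial (Fin n) k ⧸ varIdeal k n J) →ₗ[k] k,
      ∀ p, c (Ideal.Quotient.mk (varIdeal k n J) p) = coeff m p := by
  refine ⟨(Submodule.liftQ ((varIdeal k n J).restrictScalars k) (MvPolynomial.lcoeff k m) ?_) ∘ₗ
    (Submodule.Quotient.restrictScalarsEquiv k (varIdeal k n J)).symm.toLinearMap, ?_⟩
  · intro p hp
    have hp' : p ∈ varIdeal k n J := hp
    rw [mem_varIdeal_aux] at hp'
    rw [LinearMap.mem_ker]
    change coeff m p = 0
    by_contra h
    obtain ⟨i, hi, h2⟩ := hp' m (MvPolynomial.mem_support_iff.2 h)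
    exact h2 (hm i hi)
  · intro p
    rfl

theorem smul_mk_aux (k : Type) [Field k] (n : ℕ) (J : Finset (Fin n)) (a : k)
    (p : MvPolynomial (Fin n) k) :
    a • Ideal.Quotient.mk (varIdeal k n J) p = Ideal.Quotient.mk (varIdeal k n J) (a • p) := rfl

theorem internal_aux (k : Type) [Field k] (n : ℕ) (J : Finset (Fin n)) :
    DirectSum.IsInternal (mdegComponent k n J) := by
  rw [DirectSum.isInternal_submodule_iff_iSupIndep_and_iSup_eq_top]
  constructor
  · intro m'
    rw [Submodule.disjoint_def]
    intro x hx hx2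
    by_cases h : (∀ i, 0 ≤ m' i) ∧ (∀ j ∈ J, m' j = 0)
    · unfold mdegComponent at hx
      rw [if_pos h, Submodule.mem_span_singleton] at hx
      obtain ⟨a, rfl⟩ := hx
      obtain ⟨c, hc⟩ := exists_coeff_aux k n J
        (Finsupp.equivFunOnFinite.symm fun i => (m' i).toNat) (by
          intro j hj
          simp [h.2 j hj])
      have hle : (⨆ (j) (_ : j ≠ m'), mdegComponent k n J j) ≤ LinearMap.ker c := by
        refine iSup₂_le fun j hj => ?_
        unfold mdegComponent
        split_ifs with h'
        · rw [Submodule.span_singleton_le_iff_mem, LinearMap.mem_ker, hc, coeff_monomial,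
            if_neg]
          intro he
          apply hj
          funext i
          have h3 := DFunLike.congr_fun he i
          simp only [Finsupp.equivFunOnFinite_symm_apply_apply] at h3
          have := h.1 i
          have := h'.1 i
          omega
        · exact bot_le
      have h4 := hle hx2
      rw [LinearMap.mem_ker, map_smul, hc, coeff_monomial, if_pos rfl] at h4
      have : a = 0 := by simpa using h4
      rw [this, zero_smul]
    · unfold mdegComponent at hx
      rw [if_neg h] at hx
      simpa using hx
  · rw [eq_top_iff]
    rintro x -
    obtain ⟨p, rfl⟩ := Ideal.Quotient.mk_surjective x
    induction p using MvPolynomial.induction_on' with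
    | add p q hp hq => rw [map_add]; exact Submodule.add_mem _ hp hq
    | monomial m a =>
      by_cases hm : ∀ j ∈ J, m j = 0
      · refine Submodule.mem_iSup_of_mem (fun i => (m i : ℤ)) ?_
        unfold mdegComponent
        rw [if_pos ⟨fun i => by positivity, fun j hj => by simp [hm j hj]⟩,
          Submodule.mem_span_singleton]
        refine ⟨a, ?_⟩
        rw [smul_mk_aux, smul_monomial]
        congr 2
        · ext i; simp
        · simp
      · have : Ideal.Quotient.mk (varIdeal k n J) (monomial m a) = 0 := by
          rw [Ideal.Quotient.eq_zero_iff_mem, mem_varIdeal_aux]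
          intro m2 h2
          have := MvPolynomial.support_monomial_subset h2
          rw [Finset.mem_singleton] at this
          subst this
          push Not at hm
          exact hm
        rw [this]
        exact Submodule.zero_mem _

theorem apply_mk_aux (k : Type) [Field k] (n : ℕ) (I J : Finset (Fin n))
    (f : (MvPolynomial (Fin n) k ⧸ varIdeal k n I) →ₗ[MvPolynomial (Fin n) k]
      (MvPolynomial (Fin n) k ⧸ varIdeal k n J)) (p : MvPolynomial (Fin n) k) :
    f (Ideal.Quotient.mk _ p) = p • f (Ideal.Quotient.mk _ (monomial 0 (1 : k))) := by
  rw [← map_smul]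
  congr 1
  change _ = Ideal.Quotient.mk _ (p • monomial 0 (1 : k))
  congr 1
  change p = p * 1
  rw [mul_one]

theorem homog_aux (k : Type) [Field k] (n : ℕ) (I J : Finset (Fin n)) (d : Fin n → ℤ)
    (f : (MvPolynomial (Fin n) k ⧸ varIdeal k n I) →ₗ[MvPolynomial (Fin n) k]
      (MvPolynomial (Fin n) k ⧸ varIdeal k n J)) (hf : IsHomogOfDegree k n I J d f) :
    f (Ideal.Quotient.mk _ (monomial 0 (1 : k))) ∈ mdegComponent k n J d := by
  simpa using hf 0 (by simp)

/-- `S/A_J` is the internal direct sum of its multidegree components,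
and the `k`-vector space of `S`-module homomorphisms `S/A_I → S/A_J` homogeneous of
degree `d` is one-dimensional when `I ⊆ J`, `d_j = 0` for all `j ∈ J` and `d ≥ 0`,
and zero otherwise. -/
theorem stmt2 (k : Type) [Field k] (n : ℕ) (I J : Finset (Fin n)) (d : Fin n → ℤ) :
    DirectSum.IsInternal (mdegComponent k n J) ∧
    ((I ⊆ J ∧ (∀ j ∈ J, d j = 0) ∧ (∀ i, 0 ≤ d i)) →
      ∃ f, IsHomogOfDegree k n I J d f ∧ f ≠ 0 ∧
        ∀ g, IsHomogOfDegree k n I J d g → ∃ c : k, ∀ x, g x = c • f x) ∧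
    (¬ (I ⊆ J ∧ (∀ j ∈ J, d j = 0) ∧ (∀ i, 0 ≤ d i)) →
      ∀ f, IsHomogOfDegree k n I J d f → f = 0) := by

  refine ⟨internal_aux k n J, ?_, ?_⟩
  · rintro ⟨hIJ, hd, hd0⟩
    set D : Fin n →₀ ℕ := Finsupp.equivFunOnFinite.symm fun i => (d i).toNat with hD
    have hDJ : ∀ j ∈ J, D j = 0 := by
      intro j hj
      simp [hD, hd j hj]
    have hle : varIdeal k n I ≤ Submodule.comap
        (LinearMap.mulLeft (MvPolynomial (Fin n) k) (monomial D (1 : k))) (varIdeal k n J) := by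
      intro p hp
      have h1 : p ∈ varIdeal k n J := by
        rw [mem_varIdeal_aux] at hp ⊢
        intro m hm
        obtain ⟨i, hi, h⟩ := hp m hm
        exact ⟨i, hIJ hi, h⟩
      exact Ideal.mul_mem_left _ _ h1
    let f := Submodule.mapQ (varIdeal k n I) (varIdeal k n J)
        (LinearMap.mulLeft (MvPolynomial (Fin n) k) (monomial D (1 : k))) hle
    have hf : ∀ p, f (Ideal.Quotient.mk _ p) =
        Ideal.Quotient.mk (varIdeal k n J) (monomial D (1 : k) * p) := fun p => rfl
    refine ⟨f, ?_, ?_, ?_⟩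
    · intro m hm
      rw [hf, monomial_mul, one_mul]
      by_cases hmJ : ∀ j ∈ J, m j = 0
      · unfold mdegComponent
        rw [if_pos ⟨fun i => by have := hd0 i; positivity,
          fun j hj => by simp [hmJ j hj, hd j hj]⟩]
        have : (Finsupp.equivFunOnFinite.symm fun i => ((m i : ℤ) + d i).toNat) = D + m := by
          ext i
          have := hd0 i
          simp only [hD, Finsupp.equivFunOnFinite_symm_apply_apply, Finsupp.add_apply]
          omega
        rw [this]
        exact Submodule.mem_span_singleton_self _
      · have : Ideal.Quotient.mk (varIdeal k n J) (monomial (D + m) (1 : k)) = 0 := by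
          rw [Ideal.Quotient.eq_zero_iff_mem, mem_varIdeal_aux]
          intro m2 h2
          have := MvPolynomial.support_monomial_subset h2
          rw [Finset.mem_singleton] at this
          subst this
          push Not at hmJ
          obtain ⟨j, hj, h⟩ := hmJ
          exact ⟨j, hj, by simp [h]⟩
        rw [this]
        exact Submodule.zero_mem _
    · intro h0
      obtain ⟨c, hc⟩ := exists_coeff_aux k n J D hDJ
      have h1 := hc (monomial D (1 : k) * 1)
      rw [← hf, h0, LinearMap.zero_apply, map_zero, mul_one, coeff_monomial, if_pos rfl] at h1
      exact zero_ne_one h1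
    · intro g hg
      have h1 := homog_aux k n I J d g hg
      unfold mdegComponent at h1
      rw [if_pos ⟨hd0, hd⟩, Submodule.mem_span_singleton] at h1
      obtain ⟨c, h1⟩ := h1
      refine ⟨c, fun x => ?_⟩
      obtain ⟨p, rfl⟩ := Ideal.Quotient.mk_surjective x
      rw [apply_mk_aux, ← h1, hf, smul_mk_aux, smul_mk_aux]
      change Ideal.Quotient.mk _ (p * (c • monomial D (1 : k))) = _
      rw [mul_smul_comm, mul_comm]
  · intro hn f hf
    have h1 := homog_aux k n I J d f hf
    have key : f (Ideal.Quotient.mk _ (monomial 0 (1 : k))) = 0 := by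
      unfold mdegComponent at h1
      split_ifs at h1 with h
      · rw [Submodule.mem_span_singleton] at h1
        obtain ⟨a, h1⟩ := h1
        have hIJ : ¬ I ⊆ J := fun h' => hn ⟨h', h.2, h.1⟩
        rw [Finset.not_subset] at hIJ
        obtain ⟨i, hi, hiJ⟩ := hIJ
        have h2 := apply_mk_aux k n I J f (X i)
        have h3 : Ideal.Quotient.mk (varIdeal k n I) (X i) = 0 := by
          rw [Ideal.Quotient.eq_zero_iff_mem]
          exact Ideal.subset_span ⟨i, hi, rfl⟩
        rw [h3, map_zero, ← h1, smul_mk_aux] at h2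
        set D : Fin n →₀ ℕ := Finsupp.equivFunOnFinite.symm fun i => (d i).toNat with hD
        obtain ⟨c, hc⟩ := exists_coeff_aux k n J (Finsupp.single i 1 + D) (by
          intro j hj
          have : i ≠ j := fun e => hiJ (e ▸ hj)
          simp [hD, h.2 j hj, this])
        have h4 := hc (X i * (a • monomial D (1 : k)))
        have h5 : Ideal.Quotient.mk (varIdeal k n J) (X i * (a • monomial D (1 : k))) = 0 :=
          h2.symm
        rw [h5, map_zero, mul_smul_comm, X, monomial_mul, coeff_smul, coeff_monomial,
          if_pos rfl] at h4
        have ha : a = 0 := by simpa using h4.symm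
        rw [← h1, ha, zero_smul]
      · simpa using h1
    refine LinearMap.ext fun x => ?_
    obtain ⟨p, rfl⟩ := Ideal.Quotient.mk_surjective x
    rw [apply_mk_aux, key, smul_zero, LinearMap.zero_apply]
end
end

section
/- Let n be a natural number and a, b ∈ ℤ^n. Then R(a,b) holds if and only if there exists a subset S ⊆ Fin n such that S ⊆ I(a), I(a) ∖ I(b) ⊆ S, and p(b) = p(a) + χ_S. Moreover, when these equivalent conditions hold, such a subset S is unique, namely S = {i ∈ Fin n : p(b)_i = p(a)_i + 1}. -/
/-- `I(a) = {i : a i ≠ 0}`. -/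
def Isupp {n : ℕ} (a : Fin n → ℤ) : Finset (Fin n) :=
  Finset.univ.filter fun i => a i ≠ 0

/-- `p(a)_i = a_i` if `a_i ≤ 0` and `p(a)_i = a_i - 1` if `a_i > 0`. -/
def pmap {n : ℕ} (a : Fin n → ℤ) : Fin n → ℤ :=
  fun i => if a i ≤ 0 then a i else a i - 1

/-- `χ_S`, the indicator function of `S ⊆ Fin n`, valued in `ℤ`. -/
def chi {n : ℕ} (S : Finset (Fin n)) : Fin n → ℤ :=
  fun i => if i ∈ S then 1 else 0

/-- `R(a,b)`: for every `i`, either `b_i - a_i ∈ {0,1}` or `(b_i, a_i) = (1, -1)`. -/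
def Rrel {n : ℕ} (a b : Fin n → ℤ) : Prop :=
  ∀ i, (b i - a i = 0 ∨ b i - a i = 1) ∨ (b i = 1 ∧ a i = -1)

/-- `R(a,b)` holds iff there exists `S ⊆ I(a)` with
`I(a) ∖ I(b) ⊆ S` and `p(b) = p(a) + χ_S`; moreover such an `S` is unique, namely
`S = {i : p(b)_i = p(a)_i + 1}`. -/
theorem stmt5 (n : ℕ) (a b : Fin n → ℤ) :
    (Rrel a b ↔ ∃ S : Finset (Fin n), S ⊆ Isupp a ∧ Isupp a \ Isupp b ⊆ S ∧
      pmap b = pmap a + chi S) ∧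
    (∀ S : Finset (Fin n), S ⊆ Isupp a → Isupp a \ Isupp b ⊆ S →
      pmap b = pmap a + chi S →
      S = Finset.univ.filter fun i => pmap b i = pmap a i + 1) := by
  constructor
  · constructor
    · intro h
      refine ⟨Finset.univ.filter fun i => pmap b i = pmap a i + 1, ?_, ?_, ?_⟩
      · intro i hi
        have := h i
        simp only [Isupp, Finset.mem_filter, Finset.mem_univ, true_and] at hi ⊢
        simp only [pmap] at hi
        split_ifs at hi <;> omega
      · intro i hi
        have := h i
        simp only [Isupp, Finset.mem_sdiff, Finset.mem_filter, Finset.mem_univ,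
          true_and] at hi ⊢
        simp only [pmap]
        split_ifs <;> omega
      · funext i
        have := h i
        simp only [chi, Pi.add_apply, Finset.mem_filter, Finset.mem_univ, true_and]
        simp only [pmap]
        split_ifs <;> omega
    · rintro ⟨S, h1, h2, h3⟩ i
      have e1 := @h1 i
      have e2 := @h2 i
      have e3 := congrFun h3 i
      simp only [Isupp, chi, pmap, Pi.add_apply, Finset.mem_sdiff, Finset.mem_filter,
        Finset.mem_univ, true_and] at e1 e2 e3
      by_cases hS : i ∈ S <;> simp only [hS, if_true, if_false, true_imp_iff, imp_false, false_imp_iff, imp_true_iff,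
          Bool.false_eq_true] at e1 e2 e3 <;>
        split_ifs at e3 <;> omega
  · intro S _ _ h3
    ext i
    have e3 := congrFun h3 i
    simp only [chi, Pi.add_apply] at e3
    simp only [Finset.mem_filter, Finset.mem_univ, true_and]
    by_cases hS : i ∈ S <;> simp only [hS, if_true, if_false, true_iff, false_iff] at e3 ⊢ <;> omega
end

section
/- Let n be a natural number and a, b, c ∈ ℤ^n such that R(a,b), R(b,c), and R(a,c) all hold. Let S = {i : p(b)_i = p(a)_i + 1}, T = {i : p(c)_i = p(b)_i + 1}, and W = {i : p(c)_i = p(a)_i + 1}. Then S ∩ T = ∅, S ∪ T = W, and T ⊆ I(a) ∩ I(b). -/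
/-- if `R(a,b)`, `R(b,c)` and `R(a,c)` hold, then with
`S = {i : p(b)_i = p(a)_i + 1}`, `T = {i : p(c)_i = p(b)_i + 1}` and
`W = {i : p(c)_i = p(a)_i + 1}` one has `S ∩ T = ∅`, `S ∪ T = W` and
`T ⊆ I(a) ∩ I(b)`. -/
theorem stmt7 (n : ℕ) (a b c : Fin n → ℤ)
    (hab : Rrel a b) (hbc : Rrel b c) (hac : Rrel a c) :
    (Finset.univ.filter fun i => pmap b i = pmap a i + 1) ∩
        (Finset.univ.filter fun i => pmap c i = pmap b i + 1) = ∅ ∧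
    (Finset.univ.filter fun i => pmap b i = pmap a i + 1) ∪
        (Finset.univ.filter fun i => pmap c i = pmap b i + 1) =
      (Finset.univ.filter fun i => pmap c i = pmap a i + 1) ∧
    (Finset.univ.filter fun i => pmap c i = pmap b i + 1) ⊆ Isupp a ∩ Isupp b := by
  refine ⟨?_, ?_, ?_⟩
  · ext i
    have h1 := hab i
    have h2 := hbc i
    have h3 := hac i
    simp only [Finset.mem_inter, Finset.mem_filter, Finset.mem_univ, true_and,
      Finset.notMem_empty, iff_false]
    simp only [pmap]
    split_ifs <;> omega
  · ext i
    have h1 := hab i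
    have h2 := hbc i
    have h3 := hac i
    simp only [Finset.mem_union, Finset.mem_filter, Finset.mem_univ, true_and]
    simp only [pmap]
    split_ifs <;> omega
  · intro i
    have h1 := hab i
    have h2 := hbc i
    have h3 := hac i
    simp only [Finset.mem_inter, Finset.mem_filter, Finset.mem_univ, true_and, Isupp]
    simp only [pmap]
    split_ifs <;> omega
end

section
/- Let k be a field, Σ a simplicial complex on Fin n, σ ∈ Σ with |σ| ≥ 2, and Σ̃ the stellar subdivision of Σ at σ. Given z : Fin (n+1) → k, define w : Fin n → k by w_i = z_i if i ∉ σ and w_i = z_i · z_{n+1} if i ∈ σ, where z_{n+1} denotes the last coordinate of z. If {i ∈ Fin (n+1) : z_i = 0} ∈ Σ̃, then {i ∈ Fin n : w_i = 0} ∈ Σ. -/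
/-- A simplicial complex on a set `V`: a collection of finite subsets of `V`
containing the empty set and closed under taking subsets. -/
def IsSimplicialComplex {V : Type*} (K : Set (Finset V)) : Prop :=
  ∅ ∈ K ∧ ∀ I ∈ K, ∀ I' ⊆ I, I' ∈ K

/-- The subset of `Fin n` corresponding to a subset of `Fin (n+1)`, obtained by
removing the last element `n+1` (if present) and pulling back along `Fin.castSucc`. -/
noncomputable def downSet {n : ℕ} (I : Finset (Fin (n + 1))) : Finset (Fin n) :=
  I.preimage Fin.castSucc (Fin.castSucc_injective n).injOn

/-- The stellar subdivision of a simplicial complex `K` on `Fin n` at `σ`: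
subsets `I ⊆ Fin (n+1)` with `σ ⊄ I` such that either `n+1 ∉ I` and `I ∈ K`, or
`n+1 ∈ I`, `I∖{n+1} ∈ K` and `(I∖{n+1}) ∪ σ ∈ K`. -/
noncomputable def stellarSubdivision {n : ℕ} (K : Set (Finset (Fin n)))
    (σ : Finset (Fin n)) : Set (Finset (Fin (n + 1))) :=
  {I | ¬ σ.image Fin.castSucc ⊆ I ∧
    ((Fin.last n ∉ I ∧ downSet I ∈ K) ∨
      (Fin.last n ∈ I ∧ downSet I ∈ K ∧ downSet I ∪ σ ∈ K))}

open Classical in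
/-- given `z : Fin (n+1) → k`, define `w : Fin n → k` by `w_i = z_i`
for `i ∉ σ` and `w_i = z_i · z_{n+1}` for `i ∈ σ`.  If the zero set of `z` belongs
to the stellar subdivision of `K` at `σ`, then the zero set of `w` belongs to `K`. -/
theorem stmt9 (k : Type) [Field k] (n : ℕ) (K : Set (Finset (Fin n)))
    (hK : IsSimplicialComplex K) (σ : Finset (Fin n)) (hσ : σ ∈ K)
    (hcard : 2 ≤ σ.card) (z : Fin (n + 1) → k)
    (hz : (Finset.univ.filter fun i => z i = 0) ∈ stellarSubdivision K σ) :
    (Finset.univ.filter fun i : Fin n =>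
      (if i ∈ σ then z (Fin.castSucc i) * z (Fin.last n)
        else z (Fin.castSucc i)) = 0) ∈ K := by
  obtain ⟨-, h | h⟩ := hz
  · obtain ⟨h1, h2⟩ := h
    refine hK.2 _ h2 _ ?_
    intro i hi
    simp only [downSet, Finset.mem_preimage, Finset.mem_filter, Finset.mem_univ, true_and] at *
    split_ifs at hi with hs
    · exact (mul_eq_zero.mp hi).resolve_right h1
    · exact hi
  · obtain ⟨-, -, h2⟩ := h
    refine hK.2 _ h2 _ ?_
    intro i hi
    simp only [downSet, Finset.mem_union, Finset.mem_preimage, Finset.mem_filter,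
      Finset.mem_univ, true_and] at *
    split_ifs at hi with hs
    · exact Or.inr hs
    · exact Or.inl hi
end

section
/- Let G be the smallest subset of ℤ² that contains {(a₁,a₂) ∈ ℤ² : a₁ + a₂ ∈ {0,1}} and satisfies: for all (x,y) ∈ ℤ², if at least three of the four points (x,y), (x−1,y), (x,y−1), (x−1,y−1) belong to G, then all four belong to G. Then G = ℤ². -/
/-- any subset `G ⊆ ℤ²` containing `{(a₁,a₂) : a₁ + a₂ ∈ {0,1}}`
and such that whenever at least three of the four points
`(x,y), (x−1,y), (x,y−1), (x−1,y−1)` lie in `G` all four do, is all of `ℤ²`;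
hence the smallest such subset is `ℤ²`. -/
theorem stmt11 (G : Set (ℤ × ℤ))
    (hbase : ∀ a : ℤ × ℤ, a.1 + a.2 = 0 ∨ a.1 + a.2 = 1 → a ∈ G)
    (hclose : ∀ x y : ℤ,
      (((x, y) ∈ G ∧ (x - 1, y) ∈ G ∧ (x, y - 1) ∈ G) ∨
        ((x, y) ∈ G ∧ (x - 1, y) ∈ G ∧ (x - 1, y - 1) ∈ G) ∨
        ((x, y) ∈ G ∧ (x, y - 1) ∈ G ∧ (x - 1, y - 1) ∈ G) ∨
        ((x - 1, y) ∈ G ∧ (x, y - 1) ∈ G ∧ (x - 1, y - 1) ∈ G)) →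
      ((x, y) ∈ G ∧ (x - 1, y) ∈ G ∧ (x, y - 1) ∈ G ∧ (x - 1, y - 1) ∈ G)) :
    G = Set.univ := by
  have key : ∀ n : ℕ, ∀ x y : ℤ, -(n : ℤ) ≤ x + y → x + y ≤ n + 1 → (x, y) ∈ G := by
    intro n
    induction n with
    | zero =>
      intro x y h1 h2
      apply hbase
      simp only [Nat.cast_zero] at h1 h2
      show x + y = 0 ∨ x + y = 1
      omega
    | succ n ih =>
      intro x y h1 h2
      push_cast at h1 h2
      by_cases hu : x + y = n + 2
      · exact (hclose x y (Or.inr (Or.inr (Or.inr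
          ⟨ih _ _ (by omega) (by omega), ih _ _ (by omega) (by omega),
            ih _ _ (by omega) (by omega)⟩)))).1
      · by_cases hl : x + y = -(n : ℤ) - 1
        · have h := (hclose (x + 1) (y + 1) (Or.inl
            ⟨ih _ _ (by omega) (by omega), ih _ _ (by omega) (by omega),
              ih _ _ (by omega) (by omega)⟩)).2.2.2
          simpa using h
        · exact ih x y (by omega) (by omega)
  ext ⟨x, y⟩
  simp only [Set.mem_univ, iff_true]
  exact key (x + y).natAbs x y (by omega) (by omega)
end

section
/- Let G be the smallest subset of ℤ³ that contains all the points A_k (k ≥ 0), B_a (a ≠ 0), C_a (a ≠ 1), and D_k (k ≥ 0), and satisfies: for every v ∈ ℤ³ and every pair of distinct indices i, j ∈ {1,2,3}, if at least three of the four points v, v − e_i, v − e_j, v − e_i − e_j belong to G (where e_i denotes the i-th standard basis vector of ℤ³), then all four belong to G. Then G = ℤ³. -/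
/-- `A_k = (0,0,k)`. -/
def ptA (k : ℤ) : Fin 3 → ℤ := ![0, 0, k]

/-- `B_a = (a,−a,0)`. -/
def ptB (a : ℤ) : Fin 3 → ℤ := ![a, -a, 0]

/-- `C_a = (a,1−a,0)`. -/
def ptC (a : ℤ) : Fin 3 → ℤ := ![a, 1 - a, 0]

/-- `D_k = (1,0,−k)`. -/
def ptD (k : ℤ) : Fin 3 → ℤ := ![1, 0, -k]

/-- The `i`-th standard basis vector of `ℤ³`. -/
def stdBasis (i : Fin 3) : Fin 3 → ℤ := Pi.single i 1

/-- any subset `G ⊆ ℤ³` containing all the points `A_k (k ≥ 0)`,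
`B_a (a ≠ 0)`, `C_a (a ≠ 1)`, `D_k (k ≥ 0)`, and such that for every `v ∈ ℤ³` and
distinct indices `i ≠ j`, whenever at least three of the four points
`v, v − e_i, v − e_j, v − e_i − e_j` lie in `G` all four do, is all of `ℤ³`;
hence the smallest such subset is `ℤ³`. -/
theorem stmt13 (G : Set (Fin 3 → ℤ))
    (hA : ∀ k : ℤ, 0 ≤ k → ptA k ∈ G)
    (hB : ∀ a : ℤ, a ≠ 0 → ptB a ∈ G)
    (hC : ∀ a : ℤ, a ≠ 1 → ptC a ∈ G)
    (hD : ∀ k : ℤ, 0 ≤ k → ptD k ∈ G)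
    (hclose : ∀ v : Fin 3 → ℤ, ∀ i j : Fin 3, i ≠ j →
      ((v ∈ G ∧ v - stdBasis i ∈ G ∧ v - stdBasis j ∈ G) ∨
        (v ∈ G ∧ v - stdBasis i ∈ G ∧ v - stdBasis i - stdBasis j ∈ G) ∨
        (v ∈ G ∧ v - stdBasis j ∈ G ∧ v - stdBasis i - stdBasis j ∈ G) ∨
        (v - stdBasis i ∈ G ∧ v - stdBasis j ∈ G ∧ v - stdBasis i - stdBasis j ∈ G)) →
      (v ∈ G ∧ v - stdBasis i ∈ G ∧ v - stdBasis j ∈ G ∧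
        v - stdBasis i - stdBasis j ∈ G)) :
    G = Set.univ := by
  have e0 : ∀ x y z : ℤ, (![x, y, z] : Fin 3 → ℤ) - stdBasis 0 = ![x - 1, y, z] := by
    intro x y z; ext i; fin_cases i <;> simp [stdBasis]
  have e1 : ∀ x y z : ℤ, (![x, y, z] : Fin 3 → ℤ) - stdBasis 1 = ![x, y - 1, z] := by
    intro x y z; ext i; fin_cases i <;> simp [stdBasis]
  have e2 : ∀ x y z : ℤ, (![x, y, z] : Fin 3 → ℤ) - stdBasis 2 = ![x, y, z - 1] := by
    intro x y z; ext i; fin_cases i <;> simp [stdBasis]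
  have h01 := fun x y z : ℤ => hclose ![x, y, z] 0 1 (by decide)
  have h02 := fun x y z : ℤ => hclose ![x, y, z] 0 2 (by decide)
  have h12 := fun x y z : ℤ => hclose ![x, y, z] 1 2 (by decide)
  simp only [e0, e1, e2] at h01 h02 h12
  simp only [ptA, ptB, ptC, ptD] at hA hB hC hD
  obtain ⟨F, hF⟩ : ∃ F : ℤ → ℤ → ℤ → Prop, ∀ x y z, (![x, y, z] ∈ G ↔ F x y z) :=
    ⟨fun x y z => ![x, y, z] ∈ G, fun _ _ _ => Iff.rfl⟩
  simp only [hF] at hA hB hC hD h01 h02 h12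
  -- the two antidiagonals in the plane z = 0
  have d0 : ∀ x : ℤ, F x (0 - x) 0 := by
    intro x
    by_cases h : x = 0
    · subst h; simpa using hA 0 le_rfl
    · simpa using hB x h
  have d1 : ∀ x : ℤ, F x (1 - x) 0 := by
    intro x
    by_cases h : x = 1
    · subst h; simpa using hD 0 le_rfl
    · exact hC x h
  -- all antidiagonals
  have dn : ∀ n : ℤ, (∀ x, F x (n - x) 0) ∧ (∀ x, F x (n + 1 - x) 0) := by
    intro n
    induction n using Int.induction_on with
    | zero => exact ⟨d0, by simpa using d1⟩
    | succ n ih =>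
      refine ⟨ih.2, fun x => ?_⟩
      have a := ih.2 (x - 1)
      have b := ih.2 x
      have c := ih.1 (x - 1)
      refine (h01 x _ 0 (Or.inr (Or.inr (Or.inr ⟨?_, ?_, ?_⟩)))).1
      · convert a using 1; ring
      · convert b using 1; ring
      · convert c using 1; ring
    | pred n ih =>
      refine ⟨fun x => ?_, fun x => by simpa using ih.1 x⟩
      have a := ih.2 (x + 1)
      have b := ih.1 x
      have c := ih.1 (x + 1)
      have r := (h01 (x + 1) (-(n : ℤ) + 1 - (x + 1)) 0 (Or.inl ⟨a, ?_, ?_⟩)).2.2.2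
      · convert r using 1 <;> ring
      · convert b using 1 <;> ring
      · convert c using 1; ring
  have p0 : ∀ x y, F x y 0 := by
    intro x y
    simpa using (dn (x + y)).1 x
  have up : ∀ z x0 y0, (∀ x y, F x y z) → F x0 y0 (z + 1) → ∀ x y, F x y (z + 1) := by
    intro z x0 y0 h h0 x y
    have hx : ∀ x, F x y0 (z + 1) := by
      intro x
      induction x using Int.inductionOn' (b := x0) with
      | zero => exact h0
      | succ k _ ih =>
        exact (h02 (k + 1) y0 (z + 1) (Or.inr (Or.inr (Or.inr (by simp [ih, h]))))).1
      | pred k _ ih =>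
        exact (h02 k y0 (z + 1) (Or.inr (Or.inr (Or.inl (by simp [ih, h]))))).2.1
    induction y using Int.inductionOn' (b := y0) with
    | zero => exact hx x
    | succ k _ ih =>
      exact (h12 x (k + 1) (z + 1) (Or.inr (Or.inr (Or.inr (by simp [ih, h]))))).1
    | pred k _ ih =>
      exact (h12 x k (z + 1) (Or.inr (Or.inr (Or.inl (by simp [ih, h]))))).2.1
  have down : ∀ z x0 y0, (∀ x y, F x y z) → F x0 y0 (z - 1) → ∀ x y, F x y (z - 1) := by
    intro z x0 y0 h h0 x y
    have hx : ∀ x, F x y0 (z - 1) := by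
      intro x
      induction x using Int.inductionOn' (b := x0) with
      | zero => exact h0
      | succ k _ ih =>
        exact (h02 (k + 1) y0 z (Or.inr (Or.inl (by simp [ih, h])))).2.2.1
      | pred k _ ih =>
        exact (h02 k y0 z (Or.inl (by simp [ih, h]))).2.2.2
    induction y using Int.inductionOn' (b := y0) with
    | zero => exact hx x
    | succ k _ ih =>
      exact (h12 x (k + 1) z (Or.inr (Or.inl (by simp [ih, h])))).2.2.1
    | pred k _ ih =>
      exact (h12 x k z (Or.inl (by simp [ih, h]))).2.2.2
  have all : ∀ z x y, F x y z := by
    intro z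
    induction z using Int.induction_on with
    | zero => exact p0
    | succ n ih => exact up n 0 0 ih (hA _ (by omega))
    | pred n ih =>
      refine down _ 1 0 ih ?_
      have := hD (n + 1) (by omega)
      convert this using 1; ring
  ext v
  have hv : v = ![v 0, v 1, v 2] := by
    ext i; fin_cases i <;> rfl
  rw [hv, hF]
  simpa using all _ _ _
end

section
/- Let k be a field and n ≥ 1. Let C and D be categories whose objects are the elements of ℤ^n and which are k-linear (each Hom-set is a k-vector space and composition is k-bilinear), and suppose each of C and D satisfies the following two properties: (1) for p, q ∈ ℤ^n, the space Hom(p, q) is one-dimensional over k when p_i ≤ q_i for all i, and is the zero space otherwise; (2) for all p ≤ q ≤ r (coordinatewise) and all nonzero morphisms f ∈ Hom(p,q) and g ∈ Hom(q,r), the composite g ∘ f is nonzero. Then there is an equivalence of categories between C and D given by a k-linear functor acting as the identity on objects. -/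
open CategoryTheory

universe v w

/-- A type synonym for `ℤ^n` (two copies, tagged by a `Bool`), used as the object
type of the two categories `C` and `D`. -/
def ZnObj (n : ℕ) (_tag : Bool) : Type := Fin n → ℤ



theorem aux_coherent {k : Type} [Field k] {X : Type} [Category.{v} X] [Preadditive X] [Linear k X]
    (le : X → X → Prop) (hrefl : ∀ p, le p p) (htrans : ∀ p q r, le p q → le q r → le p r)
    (d : ℕ → X) (hd : ∀ m, le (d m) (d (m+1))) (hcof : ∀ p, ∃ m, le p (d m))
    (h1 : ∀ p q : X, le p q → ∃ f : p ⟶ q, f ≠ 0 ∧ ∀ g : p ⟶ q, ∃ c : k, g = c • f)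
    (h1' : ∀ p q : X, ¬ le p q → ∀ f : p ⟶ q, f = 0)
    (h2 : ∀ p q r : X, le p q → le q r → ∀ (f : p ⟶ q) (g : q ⟶ r), f ≠ 0 → g ≠ 0 → f ≫ g ≠ 0) :
    ∃ (e : ∀ p q : X, p ⟶ q) (lam : ∀ p q : X, (p ⟶ q) → k),
      (∀ p, e p p = 𝟙 p) ∧
      (∀ p q r, le p q → le q r → e p q ≫ e q r = e p r) ∧
      (∀ p q (f : p ⟶ q), f = lam p q f • e p q) ∧
      (∀ p q (c : k), le p q → lam p q (c • e p q) = c) ∧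
      (∀ p q (f : p ⟶ q), ¬ le p q → lam p q f = 0) := by
  classical
  -- cancellation
  have cancel : ∀ p q r : X, le p q → le q r → ∀ (f f' : p ⟶ q) (g : q ⟶ r), g ≠ 0 →
      f ≫ g = f' ≫ g → f = f' := by
    intro p q r hpq hqr f f' g hg h
    by_contra hne
    exact h2 p q r hpq hqr (f - f') g (sub_ne_zero.mpr hne) hg (by
      rw [Preadditive.sub_comp, h, sub_self])
  -- every nonzero morphism spans
  have span : ∀ p q : X, le p q → ∀ f g : p ⟶ q, f ≠ 0 → ∃ c : k, g = c • f := by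
    intro p q hpq f g hf
    obtain ⟨b, hb, hs⟩ := h1 p q hpq
    obtain ⟨x, hx⟩ := hs f
    obtain ⟨y, hy⟩ := hs g
    have hx0 : x ≠ 0 := by
      rintro rfl
      exact hf (by rw [hx, zero_smul])
    refine ⟨y * x⁻¹, ?_⟩
    rw [hx, hy, smul_smul, mul_assoc, inv_mul_cancel₀ hx0, mul_one]
  have hg : ∀ p q : X, ∃ f : p ⟶ q, le p q → f ≠ 0 := by
    intro p q
    by_cases h : le p q
    · obtain ⟨f, hf, -⟩ := h1 p q h
      exact ⟨f, fun _ => hf⟩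
    · exact ⟨0, fun h' => absurd h' h⟩
  choose g hg using hg
  have hT : ∀ p : X, ∃ T : ∀ m, p ⟶ d m, (∀ m, le p (d m) → T m ≠ 0) ∧
      ∀ m, le p (d m) → T (m+1) = T m ≫ g (d m) (d (m+1)) := by
    intro p
    let T : ∀ m, p ⟶ d m := fun m => Nat.rec (motive := fun m => p ⟶ d m) (g p (d 0))
      (fun m t => if le p (d m) then t ≫ g (d m) (d (m+1)) else g p (d (m+1))) m
    have hS : ∀ m, T (m+1) =
      if le p (d m) then T m ≫ g (d m) (d (m+1)) else g p (d (m+1)) := fun m => rfl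
    refine ⟨T, ?_, fun m hm => by rw [hS, if_pos hm]⟩
    intro m
    induction m with
    | zero => exact hg p (d 0)
    | succ m ih =>
      intro hm
      rw [hS]
      split_ifs with h
      · exact h2 _ _ _ h (hd m) _ _ (ih h) (hg _ _ (hd m))
      · exact hg _ _ hm
  choose T hT0 hTs using hT
  have step : ∀ p q (f : p ⟶ q) m, le p q → le q (d m) →
      (f ≫ T q m = T p m ↔ f ≫ T q (m+1) = T p (m+1)) := by
    intro p q f m hpq hq
    have hp := htrans _ _ _ hpq hq
    rw [hTs q m hq, hTs p m hp, ← Category.assoc]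
    exact ⟨fun h => by rw [h], fun h => cancel _ _ _ hp (hd m) _ _ _ (hg _ _ (hd m)) h⟩
  have mono : ∀ q m j, le q (d m) → le q (d (m+j)) := by
    intro q m j h
    induction j with
    | zero => exact h
    | succ j ih => exact htrans _ _ _ ih (hd _)
  have steps : ∀ p q (f : p ⟶ q) m j, le p q → le q (d m) →
      (f ≫ T q m = T p m ↔ f ≫ T q (m+j) = T p (m+j)) := by
    intro p q f m j hpq hq
    induction j with
    | zero => exact Iff.rfl
    | succ j ih => exact ih.trans (step p q f (m+j) hpq (mono _ _ _ hq))
  have he : ∀ p q : X, ∃ f : p ⟶ q, le p q → ∀ m, le q (d m) → f ≫ T q m = T p m := by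
    intro p q
    by_cases hpq : le p q
    · obtain ⟨m₀, hm₀⟩ := hcof q
      have hp := htrans _ _ _ hpq hm₀
      obtain ⟨c, hc⟩ := span p (d m₀) hp (g p q ≫ T q m₀) (T p m₀)
        (h2 _ _ _ hpq hm₀ _ _ (hg _ _ hpq) (hT0 _ _ hm₀))
      refine ⟨c • g p q, fun _ m hm => ?_⟩
      have h0 : (c • g p q) ≫ T q m₀ = T p m₀ := by rw [Linear.smul_comp, ← hc]
      rcases le_total m₀ m with h | h
      · obtain ⟨j, rfl⟩ := Nat.exists_eq_add_of_le h
        exact (steps _ _ _ _ j hpq hm₀).1 h0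
      · obtain ⟨j, rfl⟩ := Nat.exists_eq_add_of_le h
        exact (steps _ _ _ _ j hpq hm).2 h0
    · exact ⟨0, fun h => absurd h hpq⟩
  choose e he using he
  have he0 : ∀ p q, le p q → e p q ≠ 0 := by
    intro p q hpq h
    obtain ⟨m, hm⟩ := hcof q
    have := he p q hpq m hm
    rw [h, Limits.zero_comp] at this
    exact hT0 p m (htrans _ _ _ hpq hm) this.symm
  have hl : ∀ p q (f : p ⟶ q), ∃ c : k, f = c • e p q ∧ (¬ le p q → c = 0) := by
    intro p q f
    by_cases hpq : le p q
    · obtain ⟨c, hc⟩ := span p q hpq (e p q) f (he0 p q hpq)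
      exact ⟨c, hc, fun h => absurd hpq h⟩
    · exact ⟨0, by rw [zero_smul]; exact h1' p q hpq f, fun _ => rfl⟩
  choose lam hl hl0 using hl
  refine ⟨e, lam, ?_, ?_, hl, ?_, fun p q f h => hl0 p q f h⟩
  · intro p
    obtain ⟨m, hm⟩ := hcof p
    refine cancel p p (d m) (hrefl p) hm _ _ (T p m) (hT0 p m hm) ?_
    rw [he p p (hrefl p) m hm, Category.id_comp]
  · intro p q r hpq hqr
    obtain ⟨m, hm⟩ := hcof r
    refine cancel p r (d m) (htrans _ _ _ hpq hqr) hm _ _ (T r m) (hT0 r m hm) ?_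
    rw [he p r (htrans _ _ _ hpq hqr) m hm, Category.assoc, he q r hqr m hm,
      he p q hpq m (htrans _ _ _ hqr hm)]
  · intro p q c hpq
    have h := hl p q (c • e p q)
    rw [← sub_eq_zero, ← sub_smul] at h
    by_contra hne
    have hne' : c - lam p q (c • e p q) ≠ 0 := sub_ne_zero.mpr (Ne.symm hne)
    apply he0 p q hpq
    rw [← one_smul k (e p q), ← inv_mul_cancel₀ hne', mul_smul, h, smul_zero]

theorem aux_equiv {k : Type} [Field k] {X Y : Type} [Category.{v} X] [Preadditive X] [Linear k X]
    [Category.{w} Y] [Preadditive Y] [Linear k Y] (o : X → Y) (ho : Function.Surjective o)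
    (le : X → X → Prop) (le' : Y → Y → Prop) (hle : ∀ p q, le p q ↔ le' (o p) (o q))
    (hrefl : ∀ p, le p p)
    (e : ∀ p q : X, p ⟶ q) (lam : ∀ p q : X, (p ⟶ q) → k)
    (a1 : ∀ p, e p p = 𝟙 p)
    (a2 : ∀ p q r, le p q → le q r → e p q ≫ e q r = e p r)
    (a3 : ∀ p q (f : p ⟶ q), f = lam p q f • e p q)
    (a4 : ∀ p q (c : k), le p q → lam p q (c • e p q) = c)
    (a5 : ∀ p q (f : p ⟶ q), ¬ le p q → lam p q f = 0)
    (e' : ∀ p q : Y, p ⟶ q) (lam' : ∀ p q : Y, (p ⟶ q) → k)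
    (b1 : ∀ p, e' p p = 𝟙 p)
    (b2 : ∀ p q r, le' p q → le' q r → e' p q ≫ e' q r = e' p r)
    (b3 : ∀ p q (f : p ⟶ q), f = lam' p q f • e' p q)
    (b4 : ∀ p q (c : k), le' p q → lam' p q (c • e' p q) = c)
    (b5 : ∀ p q (f : p ⟶ q), ¬ le' p q → lam' p q f = 0) :
    ∃ F : X ⥤ Y, (∀ p, F.obj p = o p) ∧ F.IsEquivalence ∧
      ∃ hadd : F.Additive, letI := hadd; Functor.Linear k F := by
  have lam_eq : ∀ p q (f : p ⟶ q) (c : k), le p q → f = c • e p q → lam p q f = c := by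
    intro p q f c h hf
    rw [hf, a4 _ _ _ h]
  have lam_add : ∀ p q (f g : p ⟶ q), lam p q (f + g) = lam p q f + lam p q g := by
    intro p q f g
    by_cases h : le p q
    · apply lam_eq _ _ _ _ h
      rw [add_smul, ← a3, ← a3]
    · simp [a5 _ _ _ h]
  have lam_smul : ∀ p q (c : k) (f : p ⟶ q), lam p q (c • f) = c * lam p q f := by
    intro p q c f
    by_cases h : le p q
    · apply lam_eq _ _ _ _ h
      rw [mul_smul, ← a3]
    · simp [a5 _ _ _ h]
  have lam_zero : ∀ p q, lam p q 0 = 0 := by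
    intro p q
    have := lam_smul p q 0 0
    simpa using this
  have zX : ∀ p q (f : p ⟶ q), ¬ le p q → f = 0 := by
    intro p q f h
    rw [a3 p q f, a5 _ _ _ h, zero_smul]
  let F : X ⥤ Y :=
    { obj := o
      map := fun {p q} f => lam p q f • e' (o p) (o q)
      map_id := by
        intro p
        rw [lam_eq p p (𝟙 p) 1 (hrefl p) (by rw [one_smul, a1]), one_smul, b1]
      map_comp := by
        intro p q r f g
        by_cases hpq : le p q
        · by_cases hqr : le q r
          · by_cases hpr : le p r
            · have h : lam p r (f ≫ g) = lam p q f * lam q r g := by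
                apply lam_eq _ _ _ _ hpr
                conv_lhs => rw [a3 p q f, a3 q r g]
                rw [Linear.smul_comp, Linear.comp_smul, a2 _ _ _ hpq hqr, smul_smul]
              rw [h, Linear.smul_comp, Linear.comp_smul, smul_smul,
                b2 _ _ _ ((hle _ _).1 hpq) ((hle _ _).1 hqr)]
            · have h0 : e p r = 0 := zX _ _ _ hpr
              have h : e' (o p) (o r) = 0 := by
                rw [b3 _ _ (e' (o p) (o r)), b5 _ _ _ (fun h => hpr ((hle _ _).2 h)), zero_smul]
              rw [Linear.smul_comp, Linear.comp_smul,
                b2 _ _ _ ((hle _ _).1 hpq) ((hle _ _).1 hqr), h]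
              simp
          · rw [zX q r g hqr]
            simp [lam_zero]
        · rw [zX p q f hpq]
          simp [lam_zero] }
  have hF : ∀ p q (f : p ⟶ q), F.map f = lam p q f • e' (o p) (o q) := fun _ _ _ => rfl
  have hadd : F.Additive := ⟨by
    intro p q f g
    rw [hF, hF, hF, lam_add, add_smul]⟩
  have hfaith : F.Faithful := ⟨by
    intro p q f g h
    by_cases hpq : le p q
    · rw [hF, hF] at h
      have h' := congrArg (lam' (o p) (o q)) h
      rw [b4 _ _ _ ((hle _ _).1 hpq), b4 _ _ _ ((hle _ _).1 hpq)] at h'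
      rw [a3 p q f, a3 p q g, h']
    · rw [zX _ _ f hpq, zX _ _ g hpq]⟩
  have hfull : F.Full := ⟨by
    intro p q g
    by_cases hpq : le p q
    · refine ⟨lam' (o p) (o q) g • e p q, ?_⟩
      rw [hF, a4 _ _ _ hpq]
      exact (b3 _ _ g).symm
    · refine ⟨0, ?_⟩
      rw [hF, lam_zero, zero_smul]
      have := b3 (o p) (o q) g
      rw [b5 _ _ _ (fun h => hpq ((hle _ _).2 h)), zero_smul] at this
      exact this.symm⟩
  have hess : F.EssSurj := ⟨by
    intro y
    obtain ⟨x, rfl⟩ := ho y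
    exact ⟨x, ⟨Iso.refl _⟩⟩⟩
  refine ⟨F, fun _ => rfl, { }, hadd, ?_⟩
  exact ⟨by
    intro p q f c
    rw [hF, hF, lam_smul, mul_smul]⟩

/-- if `C` and `D` are `k`-linear categories whose objects are the
elements of `ℤ^n`, in which `Hom(p,q)` is one-dimensional when `p ≤ q`
coordinatewise and zero otherwise, and composition of nonzero morphisms is nonzero,
then there is a `k`-linear equivalence `C ≌ D` acting as the identity on objects. -/
theorem stmt14 (k : Type) [Field k] (n : ℕ) (hn : 1 ≤ n)
    [cC : Category.{v} (ZnObj n true)] [cD : Category.{w} (ZnObj n false)]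
    [pC : Preadditive (ZnObj n true)] [pD : Preadditive (ZnObj n false)]
    [lC : Linear k (ZnObj n true)] [lD : Linear k (ZnObj n false)]
    (hC1 : ∀ p q : Fin n → ℤ, (∀ i, p i ≤ q i) →
      ∃ f : (show ZnObj n true from p) ⟶ (show ZnObj n true from q), f ≠ 0 ∧
        ∀ g : (show ZnObj n true from p) ⟶ (show ZnObj n true from q),
          ∃ c : k, g = c • f)
    (hC1' : ∀ p q : Fin n → ℤ, ¬ (∀ i, p i ≤ q i) →
      ∀ f : (show ZnObj n true from p) ⟶ (show ZnObj n true from q), f = 0)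
    (hC2 : ∀ p q r : Fin n → ℤ, (∀ i, p i ≤ q i) → (∀ i, q i ≤ r i) →
      ∀ (f : (show ZnObj n true from p) ⟶ (show ZnObj n true from q))
        (g : (show ZnObj n true from q) ⟶ (show ZnObj n true from r)),
        f ≠ 0 → g ≠ 0 → f ≫ g ≠ 0)
    (hD1 : ∀ p q : Fin n → ℤ, (∀ i, p i ≤ q i) →
      ∃ f : (show ZnObj n false from p) ⟶ (show ZnObj n false from q), f ≠ 0 ∧
        ∀ g : (show ZnObj n false from p) ⟶ (show ZnObj n false from q),
          ∃ c : k, g = c • f)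
    (hD1' : ∀ p q : Fin n → ℤ, ¬ (∀ i, p i ≤ q i) →
      ∀ f : (show ZnObj n false from p) ⟶ (show ZnObj n false from q), f = 0)
    (hD2 : ∀ p q r : Fin n → ℤ, (∀ i, p i ≤ q i) → (∀ i, q i ≤ r i) →
      ∀ (f : (show ZnObj n false from p) ⟶ (show ZnObj n false from q))
        (g : (show ZnObj n false from q) ⟶ (show ZnObj n false from r)),
        f ≠ 0 → g ≠ 0 → f ≫ g ≠ 0) :
    ∃ F : ZnObj n true ⥤ ZnObj n false,
      (∀ p : Fin n → ℤ, F.obj p = p) ∧ F.IsEquivalence ∧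
        ∃ hadd : F.Additive, letI := hadd; Functor.Linear k F := by
  have hcof : ∀ p : Fin n → ℤ, ∃ m : ℕ, ∀ i, p i ≤ (m : ℤ) := by
    intro p
    refine ⟨∑ i, (p i).natAbs, fun i => ?_⟩
    have h := Finset.single_le_sum (f := fun i => (p i).natAbs) (fun _ _ => Nat.zero_le _)
      (Finset.mem_univ i)
    have h' : (p i).natAbs ≤ ∑ i, (p i).natAbs := h
    omega
  let le : (Fin n → ℤ) → (Fin n → ℤ) → Prop := fun p q => ∀ i, p i ≤ q i
  have hrefl : ∀ p, le p p := fun p i => le_refl _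
  have htrans : ∀ p q r, le p q → le q r → le p r := fun p q r h h' i => (h i).trans (h' i)
  let d : ℕ → (Fin n → ℤ) := fun m _ => (m : ℤ)
  have hd : ∀ m, le (d m) (d (m+1)) := fun m i => by simp [d]
  obtain ⟨e, lam, a1, a2, a3, a4, a5⟩ :=
    aux_coherent (k := k) (X := ZnObj n true) le hrefl htrans d hd hcof hC1 hC1' hC2
  obtain ⟨e', lam', b1, b2, b3, b4, b5⟩ :=
    aux_coherent (k := k) (X := ZnObj n false) le hrefl htrans d hd hcof hD1 hD1' hD2
  exact aux_equiv (k := k) (X := ZnObj n true) (Y := ZnObj n false) (fun p => p) (fun p => ⟨p, rfl⟩)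
    le le (fun _ _ => Iff.rfl) hrefl e lam a1 a2 a3 a4 a5 e' lam' b1 b2 b3 b4 b5
end

section
/- Let k be a field and n ≥ 1. Suppose given units Θ^{ij}_p ∈ kˣ for all i, j ∈ Fin n and p ∈ ℤ^n satisfying Θ^{ii}_p = 1, Θ^{ji}_p = (Θ^{ij}_p)^{−1}, and the Yang–Baxter-type relations Θ^{jk}_{p+ε_i} · Θ^{ik}_p · Θ^{ij}_{p+ε_k} = Θ^{ij}_p · Θ^{ik}_{p+ε_j} · Θ^{jk}_p for all i, j, k ∈ Fin n and all p ∈ ℤ^n. Then there exist units a^s_p ∈ kˣ (for s ∈ Fin n and p ∈ ℤ^n) such that Θ^{jk}_p · a^j_{p+ε_k} · a^k_p = a^k_{p+ε_j} · a^j_p for all j, k ∈ Fin n and all p ∈ ℤ^n. -/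
theorem aux_G {A : Type} [AddCommGroup A] (f : ℤ → A) :
    ∃ F : ℤ → A, F 0 = 0 ∧ ∀ t, F (t + 1) = F t + f t := by
  refine ⟨fun t => ∑ i ∈ Finset.range t.toNat, f i
    - ∑ i ∈ Finset.range (-t).toNat, f (-(i + 1 : ℤ)), by simp, ?_⟩
  intro t
  obtain ⟨m, rfl | rfl⟩ := t.eq_nat_or_neg
  · have h1 : ((m : ℤ) + 1).toNat = m + 1 := by omega
    have h2 : (-((m : ℤ) + 1)).toNat = 0 := by omega
    have h3 : (-(m : ℤ)).toNat = 0 := by omega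
    have h4 : (m : ℤ).toNat = m := by omega
    simp only [h1, h2, h3, h4, Finset.sum_range_succ]
    simp
  · rcases m with _ | m
    · simp
    · have h1 : (-((m + 1 : ℕ) : ℤ) + 1).toNat = 0 := by omega
      have h2 : (-(-((m + 1 : ℕ) : ℤ) + 1)).toNat = m := by omega
      have h3 : (-(-((m + 1 : ℕ) : ℤ))).toNat = m + 1 := by omega
      have h4 : (-((m + 1 : ℕ) : ℤ)).toNat = 0 := by omega
      simp only [h1, h2, h3, h4, Finset.sum_range_succ]
      push_cast
      abel

theorem aux_int {A ι : Type} [DecidableEq ι] [AddCommGroup A] (m : ι) (f : (ι → ℤ) → A) :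
    ∃ F : (ι → ℤ) → A, (∀ p, p m = 0 → F p = 0) ∧
      ∀ p, F (p + Pi.single m 1) = F p + f p := by
  choose G hG0 hG using fun f : ℤ → A => aux_G f
  refine ⟨fun p => G (fun t => f (Function.update p m t)) (p m), ?_, ?_⟩
  · intro p hp
    simp only [hp, hG0]
  · intro p
    have h : ∀ t, Function.update (p + Pi.single m 1) m t = Function.update p m t := by
      intro t
      ext i
      by_cases hi : i = m
      · subst hi; simp
      · simp [hi]
    simp only [h, Pi.add_apply, Pi.single_eq_same, hG, Function.update_eq_self]

theorem aux_uniq {A ι : Type} [DecidableEq ι] [AddCommGroup A] (m : ι) (g : (ι → ℤ) → A)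
    (h0 : ∀ p, p m = 0 → g p = 0) (h : ∀ p, g (p + Pi.single m 1) = g p) (p : ι → ℤ) :
    g p = 0 := by
  have key : ∀ t : ℤ, ∀ p, p m = t → g p = 0 := by
    intro t
    induction t using Int.induction_on with
    | zero => exact h0
    | succ i ih =>
      intro p hp
      have := h (p - Pi.single m 1)
      rw [sub_add_cancel] at this
      rw [this]
      apply ih
      simp [hp]
    | pred i ih =>
      intro p hp
      rw [← h]
      apply ih
      simp [hp]
  exact key _ p rfl

theorem aux_main {A ι : Type} [DecidableEq ι] [AddCommGroup A]
    (T : ι → ι → (ι → ℤ) → A)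
    (hd : ∀ i p, T i i p = 0) (hs : ∀ i j p, T j i p = - T i j p)
    (hY : ∀ i j l p, T j l (p + Pi.single i 1) + T i l p + T i j (p + Pi.single l 1) =
      T i j p + T i l (p + Pi.single j 1) + T j l p) (S : Finset ι) :
    ∃ a : ι → (ι → ℤ) → A, ∀ j ∈ S, ∀ l ∈ S, ∀ p,
      T j l p + a j (p + Pi.single l 1) + a l p = a l (p + Pi.single j 1) + a j p := by
  induction S using Finset.induction_on with
  | empty => exact ⟨0, by simp⟩
  | insert m S hm ih =>
    obtain ⟨a, ha⟩ := ih
    choose b hb0 hb using fun j => aux_int m (fun p =>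
      a m (p + Pi.single j 1) + a j p - T j m p - a j (p + Pi.single m 1) - a m p)
    refine ⟨fun j p => if j = m then a m p else a j p + b j p, ?_⟩
    have hmix : ∀ j p, T j m p + (a j (p + Pi.single m 1) + b j (p + Pi.single m 1)) + a m p
        = a m (p + Pi.single j 1) + (a j p + b j p) := by
      intro j p
      rw [hb]
      abel
    have hne : ∀ j ∈ S, j ≠ m := fun j hj h => hm (h ▸ hj)
    intro j hj l hl p
    rcases Finset.mem_insert.1 hj with rfl | hj2 <;> rcases Finset.mem_insert.1 hl with rfl | hl2
    · simp [hd]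
    · simp only [if_true, if_neg (hne l hl2)]
      have := hmix l p
      rw [hs l j]
      grind
    · simp only [if_true, if_neg (hne j hj2)]
      exact hmix j p
    · simp only [if_neg (hne j hj2), if_neg (hne l hl2)]
      have h1 := aux_uniq m (fun p => b j (p + Pi.single l 1) + b l p
        - b l (p + Pi.single j 1) - b j p) ?_ ?_ p
      · have h2 := ha j hj2 l hl2 p
        grind
      · intro p hp
        simp [hb0, hp, (hne j hj2).symm, (hne l hl2).symm]
      · intro p
        have e : ∀ i, p + Pi.single m 1 + Pi.single i 1 = p + Pi.single i 1 + Pi.single m 1 :=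
          fun i => add_right_comm _ _ _
        have e2 : p + Pi.single l 1 + Pi.single j 1 = p + Pi.single j 1 + Pi.single l 1 :=
          add_right_comm _ _ _
        have y := hY j l m p
        have h2 := ha j hj2 l hl2 p
        have h3 := ha j hj2 l hl2 (p + Pi.single m 1)
        simp only [e, hb, e2] at *
        grind

/-- given units `Θ^{ij}_p ∈ kˣ` with `Θ^{ii}_p = 1`,
`Θ^{ji}_p = (Θ^{ij}_p)⁻¹` and the Yang–Baxter-type relations
`Θ^{jl}_{p+ε_i} Θ^{il}_p Θ^{ij}_{p+ε_l} = Θ^{ij}_p Θ^{il}_{p+ε_j} Θ^{jl}_p`,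
there exist units `a^s_p ∈ kˣ` with
`Θ^{jl}_p · a^j_{p+ε_l} · a^l_p = a^l_{p+ε_j} · a^j_p` for all `j, l, p`. -/
theorem stmt15 (k : Type) [Field k] (n : ℕ) (hn : 1 ≤ n)
    (Θ : Fin n → Fin n → (Fin n → ℤ) → kˣ)
    (hdiag : ∀ (i : Fin n) (p : Fin n → ℤ), Θ i i p = 1)
    (hskew : ∀ (i j : Fin n) (p : Fin n → ℤ), Θ j i p = (Θ i j p)⁻¹)
    (hYB : ∀ (i j l : Fin n) (p : Fin n → ℤ),
      Θ j l (p + Pi.single i 1) * Θ i l p * Θ i j (p + Pi.single l 1) =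
        Θ i j p * Θ i l (p + Pi.single j 1) * Θ j l p) :
    ∃ a : Fin n → (Fin n → ℤ) → kˣ,
      ∀ (j l : Fin n) (p : Fin n → ℤ),
        Θ j l p * a j (p + Pi.single l 1) * a l p =
          a l (p + Pi.single j 1) * a j p := by
  obtain ⟨a, ha⟩ := aux_main (A := Additive kˣ) (ι := Fin n)
    (fun i j p => Additive.ofMul (Θ i j p)) (fun i p => hdiag i p)
    (fun i j p => hskew i j p) (fun i j l p => hYB i j l p) Finset.univ
  exact ⟨fun j p => (a j p).toMul, fun j l p =>
    ha j (Finset.mem_univ _) l (Finset.mem_univ _) p⟩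
end
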